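/- Let H = ⋃_{λ∈Λ} H_λ be a locally Hilbert space. If T, S ∈ B_loc(H), then T ∘ S ∈ B_loc(H) and T* ∈ B_loc(H), and for every λ ∈ Λ: q_λ(T ∘ S) ≤ q_λ(T) · q_λ(S), q_λ(T*) = q_λ(T), and q_λ(T* ∘ T) = q_λ(T)². In particular, B_loc(H) is a *-algebra and each q_λ is a C*-seminorm on it. -/

import Mathlib

open scoped InnerProductSpace ComplexOrder

noncomputable section

universe u v w

/-- A locally Hilbert space structure over the directed poset `Λ` on the
inner product space `H`: a monotone family of complete subspaces whose union is `H`. -/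
structure LocallyHilbert (Λ : Type v) [PartialOrder Λ] (H : Type u)
    [NormedAddCommGroup H] [InnerProductSpace ℂ H] : Type (max u v) where
  E : Λ → Submodule ℂ H
  mono : Monotone E
  isComplete : ∀ lam : Λ, IsComplete (E lam : Set H)
  exhaustive : ∀ h : H, ∃ lam : Λ, h ∈ E lam

/-- A bundled locally Hilbert space over `Λ`. -/
structure LocHilbertBundle (Λ : Type v) [PartialOrder Λ] : Type (max (u + 1) v) where
  carrier : Type u
  [ngroup : NormedAddCommGroup carrier]
  [ips : InnerProductSpace ℂ carrier]
  str : LocallyHilbert Λ carrier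

attribute [instance] LocHilbertBundle.ngroup LocHilbertBundle.ips

variable {Λ : Type v} [PartialOrder Λ]
variable {H : Type u} [NormedAddCommGroup H] [InnerProductSpace ℂ H]
variable {K : Type w} [NormedAddCommGroup K] [InnerProductSpace ℂ K]

/-- `T : H → K` is a locally bounded operator: it maps each `H_λ` into `K_λ`, boundedly,
and (equivalently to the usual formulation) the adjoints of its restrictions are
compatible, i.e. for every `k ∈ K_λ` the functional `h ↦ ⟪T h, k⟫` is represented by a
vector of `H_λ`. -/
structure IsLocallyBounded (hH : LocallyHilbert Λ H) (hK : LocallyHilbert Λ K)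
    (T : H →ₗ[ℂ] K) : Prop where
  maps_mem : ∀ lam : Λ, ∀ h ∈ hH.E lam, T h ∈ hK.E lam
  bound : ∀ lam : Λ, ∃ C : ℝ, ∀ h ∈ hH.E lam, ‖T h‖ ≤ C * ‖h‖
  adjoint_mem : ∀ lam : Λ, ∀ k ∈ hK.E lam, ∃ v ∈ hH.E lam,
    ∀ h : H, ⟪T h, k⟫_ℂ = ⟪h, v⟫_ℂ

/-- `S` is the (formal) adjoint of `T`. -/
def IsLAdjoint (T : H →ₗ[ℂ] K) (S : K →ₗ[ℂ] H) : Prop :=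
  ∀ (h : H) (k : K), ⟪T h, k⟫_ℂ = ⟪h, S k⟫_ℂ

/-- The operator norm of the restriction of `T` to the submodule `p`. -/
def restNorm (p : Submodule ℂ H) (T : H →ₗ[ℂ] K) : ℝ :=
  sInf {C : ℝ | 0 ≤ C ∧ ∀ h ∈ p, ‖T h‖ ≤ C * ‖h‖}

/-- Positive semidefiniteness of a kernel with values locally bounded operators. -/
def IsPSDKernel {X : Type*} (k : X → X → (H →ₗ[ℂ] H)) : Prop :=
  ∀ (n : ℕ) (x : Fin n → X) (h : Fin n → H),
    0 ≤ ∑ i, ∑ j, ⟪h i, k (x i) (x j) (h j)⟫_ℂ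

theorem restNorm_nonneg (p : Submodule ℂ H) (T : H →ₗ[ℂ] K) : 0 ≤ restNorm p T :=
  Real.sInf_nonneg fun _ hC => hC.1

theorem restNorm_le {p : Submodule ℂ H} {T : H →ₗ[ℂ] K} {C : ℝ} (hC : 0 ≤ C)
    (h : ∀ x ∈ p, ‖T x‖ ≤ C * ‖x‖) : restNorm p T ≤ C :=
  csInf_le ⟨0, fun _ hD => hD.1⟩ ⟨hC, h⟩

theorem norm_le_restNorm_mul {p : Submodule ℂ H} {T : H →ₗ[ℂ] K}
    (hT : ∃ C : ℝ, ∀ x ∈ p, ‖T x‖ ≤ C * ‖x‖) {x : H} (hx : x ∈ p) :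
    ‖T x‖ ≤ restNorm p T * ‖x‖ := by
  obtain ⟨C, hC⟩ := hT
  have hne : {C : ℝ | 0 ≤ C ∧ ∀ y ∈ p, ‖T y‖ ≤ C * ‖y‖}.Nonempty :=
    ⟨|C|, abs_nonneg C, fun y hy => (hC y hy).trans (by gcongr; exact le_abs_self C)⟩
  rcases (norm_nonneg x).eq_or_lt with h0 | h0
  · have := hC x hx
    rw [← h0] at this ⊢
    simpa using this
  · rw [← div_le_iff₀ h0]
    exact le_csInf hne fun D hD => (div_le_iff₀ h0).2 (hD.2 x hx)

theorem IsLAdjoint.symm {T : H →ₗ[ℂ] K} {S : K →ₗ[ℂ] H} (h : IsLAdjoint T S) :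
    IsLAdjoint S T := fun k x => by
  rw [← inner_conj_symm, ← h x k, inner_conj_symm]

theorem IsLAdjoint.norm_apply_le {T : H →ₗ[ℂ] K} {S : K →ₗ[ℂ] H} (h : IsLAdjoint T S)
    {p : Submodule ℂ H} (hT : ∃ C : ℝ, ∀ x ∈ p, ‖T x‖ ≤ C * ‖x‖) {k : K} (hk : S k ∈ p) :
    ‖S k‖ ≤ restNorm p T * ‖k‖ := by
  have hsq : ‖S k‖ * ‖S k‖ ≤ (restNorm p T * ‖k‖) * ‖S k‖ :=
    calc ‖S k‖ * ‖S k‖ = ‖⟪T (S k), k⟫_ℂ‖ := by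
          rw [h, inner_self_eq_norm_sq_to_K, norm_pow, RCLike.norm_ofReal, abs_norm, sq]
      _ ≤ ‖T (S k)‖ * ‖k‖ := norm_inner_le_norm _ _
      _ ≤ (restNorm p T * ‖S k‖) * ‖k‖ := by
          gcongr
          exact norm_le_restNorm_mul hT hk
      _ = (restNorm p T * ‖k‖) * ‖S k‖ := by ring
  rcases (norm_nonneg (S k)).eq_or_lt with h0 | h0
  · rw [← h0]
    exact mul_nonneg (restNorm_nonneg p T) (norm_nonneg k)
  · exact le_of_mul_le_mul_right hsq h0

theorem norm_comp_apply_le {L : Type*} [NormedAddCommGroup L] [InnerProductSpace ℂ L]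
    {p : Submodule ℂ H} {q : Submodule ℂ K} {S : H →ₗ[ℂ] K} {T : K →ₗ[ℂ] L}
    (hS : ∃ C : ℝ, ∀ x ∈ p, ‖S x‖ ≤ C * ‖x‖) (hT : ∃ C : ℝ, ∀ x ∈ q, ‖T x‖ ≤ C * ‖x‖)
    (hpq : ∀ x ∈ p, S x ∈ q) {x : H} (hx : x ∈ p) :
    ‖(T ∘ₗ S) x‖ ≤ restNorm q T * restNorm p S * ‖x‖ :=
  calc ‖T (S x)‖ ≤ restNorm q T * ‖S x‖ := norm_le_restNorm_mul hT (hpq x hx)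
    _ ≤ restNorm q T * (restNorm p S * ‖x‖) :=
        mul_le_mul_of_nonneg_left (norm_le_restNorm_mul hS hx) (restNorm_nonneg q T)
    _ = restNorm q T * restNorm p S * ‖x‖ := by ring

theorem restNorm_sq_le_of_isLAdjoint {T : H →ₗ[ℂ] K} {S : K →ₗ[ℂ] H} (h : IsLAdjoint T S)
    {p : Submodule ℂ H} (hST : ∃ C : ℝ, ∀ x ∈ p, ‖(S ∘ₗ T) x‖ ≤ C * ‖x‖) :
    restNorm p T ^ 2 ≤ restNorm p (S ∘ₗ T) := by
  have hT : restNorm p T ≤ √(restNorm p (S ∘ₗ T)) := by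
    refine restNorm_le (Real.sqrt_nonneg _) fun x hx => ?_
    refine le_of_pow_le_pow_left₀ two_ne_zero (by positivity) ?_
    rw [mul_pow, Real.sq_sqrt (restNorm_nonneg _ _)]
    calc ‖T x‖ ^ 2 = ‖⟪x, S (T x)⟫_ℂ‖ := by
          rw [← h, inner_self_eq_norm_sq_to_K, norm_pow, RCLike.norm_ofReal, abs_norm]
      _ ≤ ‖x‖ * ‖(S ∘ₗ T) x‖ := norm_inner_le_norm _ _
      _ ≤ ‖x‖ * (restNorm p (S ∘ₗ T) * ‖x‖) := by
          gcongr
          exact norm_le_restNorm_mul hST hx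
      _ = restNorm p (S ∘ₗ T) * ‖x‖ ^ 2 := by ring
  calc restNorm p T ^ 2 ≤ √(restNorm p (S ∘ₗ T)) ^ 2 := by
        gcongr
        exact restNorm_nonneg p T
    _ = restNorm p (S ∘ₗ T) := Real.sq_sqrt (restNorm_nonneg _ _)

theorem IsLocallyBounded.comp {L : Type*} [NormedAddCommGroup L] [InnerProductSpace ℂ L]
    {hH : LocallyHilbert Λ H} {hK : LocallyHilbert Λ K} {hL : LocallyHilbert Λ L}
    {T : K →ₗ[ℂ] L} {S : H →ₗ[ℂ] K} (hT : IsLocallyBounded hK hL T)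
    (hS : IsLocallyBounded hH hK S) : IsLocallyBounded hH hL (T ∘ₗ S) where
  maps_mem lam x hx := hT.maps_mem lam _ (hS.maps_mem lam x hx)
  bound lam := ⟨_, fun _ hx =>
    norm_comp_apply_le (hS.bound lam) (hT.bound lam) (hS.maps_mem lam) hx⟩
  adjoint_mem lam k hk := by
    obtain ⟨v, hv, hv'⟩ := hT.adjoint_mem lam k hk
    obtain ⟨w, hw, hw'⟩ := hS.adjoint_mem lam v hv
    exact ⟨w, hw, fun x => (hv' (S x)).trans (hw' x)⟩

theorem IsLocallyBounded.of_isLAdjoint {hH : LocallyHilbert Λ H} {hK : LocallyHilbert Λ K}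
    {T : H →ₗ[ℂ] K} {S : K →ₗ[ℂ] H} (hT : IsLocallyBounded hH hK T) (h : IsLAdjoint T S) :
    IsLocallyBounded hK hH S := by
  have hmem : ∀ lam, ∀ k ∈ hK.E lam, S k ∈ hH.E lam := fun lam k hk => by
    obtain ⟨v, hv, hv'⟩ := hT.adjoint_mem lam k hk
    rwa [ext_inner_left ℂ fun x => (h x k).symm.trans (hv' x)]
  exact ⟨hmem, fun lam => ⟨_, fun k hk => h.norm_apply_le (hT.bound lam) (hmem lam k hk)⟩,
    fun lam k hk => ⟨T k, hT.maps_mem lam k hk, fun x => h.symm x k⟩⟩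

theorem IsLocallyBounded.restNorm_le_of_isLAdjoint {hH : LocallyHilbert Λ H}
    {hK : LocallyHilbert Λ K} {T : H →ₗ[ℂ] K} {S : K →ₗ[ℂ] H}
    (hT : IsLocallyBounded hH hK T) (h : IsLAdjoint T S) (lam : Λ) :
    restNorm (hK.E lam) S ≤ restNorm (hH.E lam) T :=
  restNorm_le (restNorm_nonneg _ _) fun k hk =>
    h.norm_apply_le (hT.bound lam) ((hT.of_isLAdjoint h).maps_mem lam k hk)

/-- `B_loc(H)` is a `*`-algebra: composition and adjoints of locally
bounded operators are locally bounded, and each seminorm `q_λ(T) = ‖T_λ‖` satisfies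
`q_λ(T ∘ S) ≤ q_λ(T) q_λ(S)`, `q_λ(T*) = q_λ(T)` and the C*-identity
`q_λ(T* ∘ T) = q_λ(T)²`. -/
theorem locallyBounded_cstar_seminorms
    {Λ : Type v} [PartialOrder Λ] [Nonempty Λ] [IsDirected Λ (· ≤ ·)]
    {H : Type u} [NormedAddCommGroup H] [InnerProductSpace ℂ H]
    (hH : LocallyHilbert Λ H)
    (T S : H →ₗ[ℂ] H)
    (hT : IsLocallyBounded hH hH T) (hS : IsLocallyBounded hH hH S) :
    IsLocallyBounded hH hH (T ∘ₗ S) ∧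
    (∀ Tstar : H →ₗ[ℂ] H, IsLAdjoint T Tstar → IsLocallyBounded hH hH Tstar) ∧
    (∀ lam : Λ, restNorm (hH.E lam) (T ∘ₗ S) ≤
      restNorm (hH.E lam) T * restNorm (hH.E lam) S) ∧
    (∀ Tstar : H →ₗ[ℂ] H, IsLAdjoint T Tstar →
      ∀ lam : Λ, restNorm (hH.E lam) Tstar = restNorm (hH.E lam) T) ∧
    (∀ Tstar : H →ₗ[ℂ] H, IsLAdjoint T Tstar →
      ∀ lam : Λ, restNorm (hH.E lam) (Tstar ∘ₗ T) = restNorm (hH.E lam) T ^ 2) := by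
  have hcomp : ∀ {A B : H →ₗ[ℂ] H}, IsLocallyBounded hH hH A → IsLocallyBounded hH hH B →
      ∀ lam, restNorm (hH.E lam) (A ∘ₗ B) ≤ restNorm (hH.E lam) A * restNorm (hH.E lam) B :=
    fun hA hB lam => restNorm_le (mul_nonneg (restNorm_nonneg _ _) (restNorm_nonneg _ _))
      fun _ hx => norm_comp_apply_le (hB.bound lam) (hA.bound lam) (hB.maps_mem lam) hx
  have hadj : ∀ Tstar : H →ₗ[ℂ] H, IsLAdjoint T Tstar → ∀ lam : Λ,
      restNorm (hH.E lam) Tstar = restNorm (hH.E lam) T := fun Tstar h lam =>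
    (hT.restNorm_le_of_isLAdjoint h lam).antisymm
      ((hT.of_isLAdjoint h).restNorm_le_of_isLAdjoint h.symm lam)
  refine ⟨hT.comp hS, fun _ h => hT.of_isLAdjoint h, hcomp hT hS, hadj, fun Tstar h lam => ?_⟩
  have hTstar := hT.of_isLAdjoint h
  refine le_antisymm ?_ (restNorm_sq_le_of_isLAdjoint h ((hTstar.comp hT).bound lam))
  calc restNorm (hH.E lam) (Tstar ∘ₗ T)
      ≤ restNorm (hH.E lam) Tstar * restNorm (hH.E lam) T := hcomp hTstar hT lam
    _ = restNorm (hH.E lam) T ^ 2 := by rw [hadj Tstar h lam, sq]
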